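/- For every odd prime power q ≥ 9 with q ≡ 1 (mod 4) there exists a mixed graph on exactly 4q² − 4 vertices which is a [(q−1)/4, q; 6]-mixed graph; that is, n[(q−1)/4, q; 6] ≤ 4q² − 4. -/

import Mathlib

/-- A mixed cycle of length `k`: for `k = 2`, a pair of distinct vertices with arcs
in both directions; for `k ≥ 3`, an injective map `ZMod k → V` in which every
consecutive step is an edge or an arc. -/
def HasMixedCycle {V : Type} (E A : V → V → Prop) (k : ℕ) : Prop :=
  (k = 2 ∧ ∃ u v : V, u ≠ v ∧ A u v ∧ A v u) ∨
  (3 ≤ k ∧ ∃ f : ZMod k → V, Function.Injective f ∧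
    ∀ i, E (f i) (f (i + 1)) ∨ A (f i) (f (i + 1)))

/-- `IsMixedGraph E A` says that `(E, A)` is a mixed graph: `E` is a symmetric
irreflexive edge relation, `A` is an irreflexive arc relation, and no pair of
vertices is related both by an edge and by an arc (in either direction). -/
def IsMixedGraph {V : Type} (E A : V → V → Prop) : Prop :=
  (∀ u v, E u v → E v u) ∧ (∀ v, ¬ E v v) ∧ (∀ v, ¬ A v v) ∧
  (∀ u v, E u v → ¬ A u v ∧ ¬ A v u)

/-- `IsZRSixMixedGraph z r E A` says that `(E, A)` is a `[z, r; 6]`-mixed graph: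
a mixed graph in which every vertex has exactly `z` out-neighbors and `z`
in-neighbors under `A` and exactly `r` neighbors under `E`, and in which the
minimum length of a mixed cycle is exactly `6`. -/
def IsZRSixMixedGraph {V : Type} (z r : ℕ) (E A : V → V → Prop) : Prop :=
  IsMixedGraph E A ∧
  (∀ v, {w | A v w}.ncard = z) ∧
  (∀ v, {w | A w v}.ncard = z) ∧
  (∀ v, {w | E v w}.ncard = r) ∧
  IsLeast {k : ℕ | HasMixedCycle E A k} 6


namespace MixedCage

variable {F : Type} [Field F]

/-- Nonzero vectors of the plane. -/
abbrev Vec (F : Type) [Field F] := {v : F × F // v ≠ 0}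

/-- Vertices: copy, type (point or line), nonzero vector. -/
abbrev Vert (F : Type) [Field F] := Bool × Bool × Vec F

/-- The bilinear form. -/
def dot (v w : Vec F) : F := v.1.1 * w.1.1 + v.1.2 * w.1.2

/-- Scaling a nonzero vector by a unit. -/
def scale (s : Fˣ) (v : Vec F) : Vec F :=
  ⟨s • v.1, by
    have := v.2
    rwa [Ne, smul_eq_zero_iff_eq]⟩

/-- Edge relation: incidence inside a copy. -/
def EE (u w : Vert F) : Prop := w.1 = u.1 ∧ w.2.1 = !u.2.1 ∧ dot u.2.2 w.2.2 = 1

/-- Arc relation: scaling between the copies. -/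
def AA (m : ℕ) (i : Fˣ) (u w : Vert F) : Prop :=
  w.1 = (!u.1) ∧ w.2.1 = u.2.1 ∧ ∃ s : Fˣ, s ^ m = (bif u.1 then i else 1) ∧ w.2.2 = scale s u.2.2

lemma dot_comm (v w : Vec F) : dot v w = dot w v := by
  unfold dot; ring

lemma dot_scale (s : Fˣ) (v w : Vec F) : dot v (scale s w) = s * dot v w := by
  simp only [dot, scale, Prod.smul_fst, Prod.smul_snd, Units.smul_def, smul_eq_mul]; ring

lemma scale_dot (s : Fˣ) (v w : Vec F) : dot (scale s v) w = s * dot v w := by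
  rw [dot_comm, dot_scale, dot_comm]

lemma scale_scale (s t : Fˣ) (v : Vec F) : scale s (scale t v) = scale (s * t) v := by
  apply Subtype.ext; simp [scale, mul_smul]

lemma one_scale (v : Vec F) : scale 1 v = v := by
  apply Subtype.ext; simp [scale]

lemma scale_inj {s t : Fˣ} {v : Vec F} (h : scale s v = scale t v) : s = t := by
  have h1 := congrArg Subtype.val h
  obtain ⟨⟨a, b⟩, hv⟩ := v
  simp only [scale, Units.smul_def, Prod.smul_mk, smul_eq_mul, Prod.mk.injEq] at h1
  apply Units.ext
  by_cases ha : a = 0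
  · by_cases hb : b = 0
    · exact absurd (by simp [ha, hb]) hv
    · exact mul_right_cancel₀ hb h1.2
  · exact mul_right_cancel₀ ha h1.1

lemma four_edges {v v' w w' : Vec F} (h1 : dot v w = 1) (h2 : dot v' w = 1)
    (h3 : dot v' w' = 1) (h4 : dot v w' = 1) (hv : v ≠ v') : w = w' := by
  obtain ⟨⟨a, b⟩, hv1⟩ := v
  obtain ⟨⟨c, d⟩, hv2⟩ := v'
  obtain ⟨⟨x, y⟩, hw1⟩ := w
  obtain ⟨⟨z, t⟩, hw2⟩ := w'
  simp only [dot] at h1 h2 h3 h4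
  have hD : a * d - b * c ≠ 0 := by
    intro hD
    apply hv
    have e1 : a = c := by linear_combination (-a) * h2 + c * h1 + y * hD
    have e2 : b = d := by linear_combination (-b) * h2 + d * h1 - x * hD
    subst e1 e2; rfl
  have e1 : x = z := mul_left_cancel₀ hD (by linear_combination d * h1 - d * h4 - b * h2 + b * h3)
  have e2 : y = t := mul_left_cancel₀ hD (by linear_combination a * h2 - a * h3 - c * h1 + c * h4)
  subst e1 e2; rfl

lemma no_two {m : ℕ} {i : Fˣ} (hi : i ≠ 1) {u v : Vert F} (h1 : AA m i u v) (h2 : AA m i v u) :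
    False := by
  obtain ⟨a1, -, s, hs, e1⟩ := h1
  obtain ⟨-, -, t, ht, e2⟩ := h2
  rw [e1, scale_scale] at e2
  have h := scale_inj ((one_scale _).trans e2)
  have h' := congrArg (· ^ m) h
  simp only [one_pow, mul_pow, hs, ht, a1] at h'
  cases hu : u.1 <;> simp [hu] at h' <;> exact hi h'.symm

lemma step_parity {m : ℕ} {i : Fˣ} {u v : Vert F} (h : EE u v ∨ AA m i u v) :
    xor v.1 v.2.1 = !(xor u.1 u.2.1) := by
  rcases h with ⟨h1, h2, -⟩ | ⟨h1, h2, -⟩ <;> rw [h1, h2] <;> cases u.1 <;> cases u.2.1 <;> rfl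

lemma no_eeaa {m : ℕ} {i : Fˣ} (hi : i ≠ 1) {a b c d : Vert F} (h1 : EE a b) (h2 : EE b c)
    (h3 : AA m i c d) (h4 : AA m i d a) : False := by
  obtain ⟨-, -, d1⟩ := h1
  obtain ⟨-, -, d2⟩ := h2
  obtain ⟨a1, -, s, hs, e1⟩ := h3
  obtain ⟨-, -, t, ht, e2⟩ := h4
  rw [e2, e1, scale_scale, scale_dot, dot_comm, d2, mul_one] at d1
  have h : t * s = 1 := Units.ext d1
  have h' := congrArg (· ^ m) h
  simp only [one_pow, mul_pow, hs, ht, a1] at h'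
  cases hu : c.1 <;> simp [hu] at h' <;> exact hi h'

lemma no_eaea {m : ℕ} {i : Fˣ} (hi : i ≠ 1) {a b c d : Vert F} (h1 : EE a b) (h2 : AA m i b c)
    (h3 : EE c d) (h4 : AA m i d a) : False := by
  obtain ⟨-, -, d1⟩ := h1
  obtain ⟨a1, -, s, hs, e1⟩ := h2
  obtain ⟨a2, -, d2⟩ := h3
  obtain ⟨-, -, t, ht, e2⟩ := h4
  rw [e2, scale_dot] at d1
  rw [e1, scale_dot, dot_comm] at d2
  have hz : dot d.2.2 b.2.2 ≠ 0 := by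
    intro h; simp [h] at d1
  have h : t = s := Units.ext (mul_right_cancel₀ hz (d1.trans d2.symm))
  subst h
  rw [hs, a2, a1] at ht
  cases hu : b.1 <;> simp [hu] at ht
  · exact hi ht.symm
  · exact hi ht

lemma no_aaaa {m : ℕ} {i : Fˣ} (hi : i ^ 2 ≠ 1) {a b c d : Vert F} (h1 : AA m i a b)
    (h2 : AA m i b c) (h3 : AA m i c d) (h4 : AA m i d a) : False := by
  obtain ⟨a1, -, s1, p1, e1⟩ := h1
  obtain ⟨a2, -, s2, p2, e2⟩ := h2
  obtain ⟨a3, -, s3, p3, e3⟩ := h3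
  obtain ⟨a4, -, s4, p4, e4⟩ := h4
  rw [e3, e2, e1, scale_scale, scale_scale, scale_scale] at e4
  have h := scale_inj ((one_scale _).trans e4)
  have h' := congrArg (· ^ m) h
  simp only [one_pow, mul_pow, p1, p2, p3, p4, a3, a2, a1] at h'
  apply hi
  rw [pow_two]
  cases hu : a.1 <;> simp [hu] at h' <;> exact h'.symm

lemma E_A_contra {m : ℕ} {i : Fˣ} {u v : Vert F} (h1 : EE u v) (h2 : AA m i u v) : False := by
  have h := h1.1.symm.trans h2.1
  cases hu : u.1 <;> simp [hu] at h

lemma EE_symm {u v : Vert F} (h : EE u v) : EE v u :=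
  ⟨h.1.symm, by rw [h.2.1]; simp, by rw [dot_comm]; exact h.2.2⟩

lemma no_four {m : ℕ} {i : Fˣ} (hi : i ^ 2 ≠ 1) {a b c d : Vert F} (hac : a ≠ c) (hbd : b ≠ d)
    (h1 : EE a b ∨ AA m i a b) (h2 : EE b c ∨ AA m i b c)
    (h3 : EE c d ∨ AA m i c d) (h4 : EE d a ∨ AA m i d a) : False := by
  have hi1 : i ≠ 1 := by rintro rfl; simp at hi
  rcases h1 with h1 | h1 <;> rcases h2 with h2 | h2 <;> rcases h3 with h3 | h3 <;>
    rcases h4 with h4 | h4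
  · -- EEEE
    have hb : b.2.2 = d.2.2 := by
      refine four_edges (v := a.2.2) (v' := c.2.2) h1.2.2 ?_ h3.2.2 ?_ ?_
      · rw [dot_comm]; exact h2.2.2
      · rw [dot_comm]; exact h4.2.2
      · intro h
        apply hac
        refine Prod.ext ?_ (Prod.ext ?_ h)
        · rw [h2.1, h1.1]
        · rw [h2.2.1, h1.2.1]; simp
    apply hbd
    refine Prod.ext ?_ (Prod.ext ?_ hb)
    · rw [h3.1, h2.1]
    · rw [h3.2.1, h2.2.1]; simp
  · have := h4.1; rw [h3.1, h2.1, h1.1] at this; cases h : a.1 <;> simp [h] at this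
  · have := h4.1; rw [h3.1, h2.1, h1.1] at this; cases h : a.1 <;> simp [h] at this
  · exact no_eeaa hi1 h1 h2 h3 h4
  · have := h4.1; rw [h3.1, h2.1, h1.1] at this; cases h : a.1 <;> simp [h] at this
  · exact no_eaea hi1 h1 h2 h3 h4
  · exact no_eeaa hi1 h4 h1 h2 h3
  · have := h4.1; rw [h3.1, h2.1, h1.1] at this; cases h : a.1 <;> simp [h] at this
  · have := h4.1; rw [h3.1, h2.1, h1.1] at this; cases h : a.1 <;> simp [h] at this
  · exact no_eeaa hi1 h2 h3 h4 h1
  · exact no_eaea hi1 h2 h3 h4 h1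
  · have := h4.1; rw [h3.1, h2.1, h1.1] at this; cases h : a.1 <;> simp [h] at this
  · exact no_eeaa hi1 h3 h4 h1 h2
  · have := h4.1; rw [h3.1, h2.1, h1.1] at this; cases h : a.1 <;> simp [h] at this
  · have := h4.1; rw [h3.1, h2.1, h1.1] at this; cases h : a.1 <;> simp [h] at this
  · exact no_aaaa hi h1 h2 h3 h4

lemma flip_odd {n : ℕ} (p : ℕ → Bool) (h : ∀ j, p (j + 1) = !p j) (hn : p n = p 0) : Even n := by
  have key : ∀ j, p j = xor (p 0) (decide (j % 2 = 1)) := by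
    intro j
    induction j with
    | zero => simp
    | succ k ih =>
      rw [h, ih]
      rcases Nat.mod_two_eq_zero_or_one k with h0 | h0 <;>
        cases p 0 <;> simp [Nat.add_mod, h0]
  rw [key n] at hn
  rcases Nat.mod_two_eq_zero_or_one n with h0 | h0
  · exact Nat.even_iff.2 h0
  · cases hp : p 0 <;> simp [h0, hp] at hn

lemma girth_lower {m : ℕ} {i : Fˣ} (hi : i ^ 2 ≠ 1) {k : ℕ}
    (h : HasMixedCycle (V := Vert F) EE (AA m i) k) : 6 ≤ k := by
  have hi1 : i ≠ 1 := by rintro rfl; simp at hi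
  rcases h with ⟨-, u, v, -, h1, h2⟩ | ⟨hk, f, hf, hs⟩
  · exact (no_two hi1 h1 h2).elim
  by_contra hlt
  have hev : Even k := by
    refine flip_odd (fun j => xor (f (j : ZMod k)).1 (f (j : ZMod k)).2.1) ?_ ?_
    · intro j
      have := step_parity (hs (j : ZMod k))
      simpa using this
    · simp
  have hk4 : k = 4 := by
    obtain ⟨r, hr⟩ := hev
    omega
  subst hk4
  refine no_four hi (a := f 0) (b := f 1) (c := f 2) (d := f 3) ?_ ?_ (hs 0) (hs 1) (hs 2) (hs 3)
  · intro h; exact absurd (hf h) (by decide)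
  · intro h; exact absurd (hf h) (by decide)

lemma hexagon {m : ℕ} {i : Fˣ} : HasMixedCycle (V := Vert F) EE (AA m i) 6 := by
  right
  refine ⟨by norm_num, ?_⟩
  let g : Fin 6 → Vert F := ![
    (false, false, ⟨(1, 0), by simp⟩), (false, true, ⟨(1, 1), by simp⟩),
    (false, false, ⟨(0, 1), by simp⟩), (false, true, ⟨(0, 1), by simp⟩),
    (false, false, ⟨(1, 1), by simp⟩), (false, true, ⟨(1, 0), by simp⟩)]
  refine ⟨g, ?_, ?_⟩
  · intro (x : Fin 6) (y : Fin 6) hxy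
    fin_cases x <;> fin_cases y <;> simp [g] at hxy <;> rfl
  · intro (x : Fin 6)
    left
    show EE (g x) (g (x + 1))
    fin_cases x <;> simp [g, EE, dot]

lemma card_E [Finite F] (u : Vert F) : {w : Vert F | EE u w}.ncard = Nat.card F := by
  obtain ⟨cc, tt, ⟨⟨a, b⟩, hv⟩⟩ := u
  rw [← Set.ncard_univ]
  symm
  by_cases ha : a = 0
  · have hb : b ≠ 0 := by
      rintro rfl; exact hv (by simp [ha])
    subst ha
    refine Set.ncard_congr (fun x _ => (cc, !tt, ⟨(x, b⁻¹), by simp [hb]⟩)) ?_ ?_ ?_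
    · intro x _
      simp [EE, dot, hb]
    · intro x y _ _ h
      simpa using h
    · rintro ⟨c', t', ⟨⟨x, y⟩, hw⟩⟩ ⟨h1, h2, h3⟩
      simp only [dot] at h1 h2 h3
      refine ⟨x, trivial, ?_⟩
      have : y = b⁻¹ := by field_simp; linear_combination h3
      subst h1 h2 this
      rfl
  · refine Set.ncard_congr (fun x _ => (cc, !tt, ⟨((1 - b * x) / a, x), ?_⟩)) ?_ ?_ ?_
    · intro h
      simp only [Prod.mk_eq_zero] at h
      obtain ⟨h1, rfl⟩ := h
      simp [ha] at h1
    · intro x _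
      simp only [EE, dot, Set.mem_ofPred_eq, true_and]
      field_simp; ring
    · intro x y _ _ h
      simp only [Prod.mk.injEq, Subtype.mk.injEq] at h
      exact h.2.2.2
    · rintro ⟨c', t', ⟨⟨x, y⟩, hw⟩⟩ ⟨h1, h2, h3⟩
      simp only [dot] at h1 h2 h3
      refine ⟨y, trivial, ?_⟩
      have : x = (1 - b * y) / a := by field_simp; linear_combination h3
      subst h1 h2 this
      rfl

lemma card_out {m : ℕ} {i : Fˣ} (u : Vert F) :
    {w : Vert F | AA m i u w}.ncard = {s : Fˣ | s ^ m = bif u.1 then i else 1}.ncard := by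
  symm
  refine Set.ncard_congr (fun s _ => (!u.1, u.2.1, scale s u.2.2)) ?_ ?_ ?_
  · intro s hs
    exact ⟨rfl, rfl, s, hs, rfl⟩
  · intro s t _ _ h
    simp only [Prod.mk.injEq] at h
    exact scale_inj h.2.2
  · rintro w ⟨h1, h2, s, hs, h3⟩
    exact ⟨s, hs, Prod.ext h1.symm (Prod.ext h2.symm h3.symm)⟩

lemma card_in {m : ℕ} {i : Fˣ} (u : Vert F) :
    {w : Vert F | AA m i w u}.ncard = {s : Fˣ | s ^ m = bif !u.1 then i else 1}.ncard := by
  symm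
  refine Set.ncard_congr (fun s _ => (!u.1, u.2.1, scale s⁻¹ u.2.2)) ?_ ?_ ?_
  · intro s hs
    exact ⟨by simp, rfl, s, hs, by simp [scale_scale, one_scale]⟩
  · intro s t _ _ h
    simp only [Prod.mk.injEq] at h
    exact inv_injective (scale_inj h.2.2)
  · rintro w ⟨h1, h2, s, hs, h3⟩
    refine ⟨s, ?_, Prod.ext ?_ (Prod.ext h2 ?_)⟩
    · rw [h1]; simpa using hs
    · rw [h1]; simp
    · simp [h3, scale_scale, one_scale]

lemma unit_data [Finite F] {m : ℕ} (hm : 0 < m) (hF : Nat.card F = 4 * m + 1) :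
    ∃ i : Fˣ, i ^ 2 ≠ 1 ∧ ∀ c : Bool, {s : Fˣ | s ^ m = bif c then i else 1}.ncard = m := by
  classical
  have := Fintype.ofFinite F
  have hU : Nat.card Fˣ = 4 * m := by rw [Nat.card_units, hF]; rfl
  obtain ⟨g, hg⟩ := IsCyclic.exists_generator (α := Fˣ)
  have ho : orderOf g = 4 * m := by rw [orderOf_eq_card_of_forall_mem_zpowers hg, hU]
  have h1 : {s : Fˣ | s ^ m = 1}.ncard = m := by
    have hd : m ∣ Nat.card Fˣ := hU ▸ Dvd.intro_left 4 rfl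
    have h := IsCyclic.card_powMonoidHom_ker (G := Fˣ) m
    rw [Nat.gcd_eq_right hd] at h
    rw [← Nat.card_coe_set_eq]
    exact h
  refine ⟨g ^ m, ?_, ?_⟩
  · rw [← pow_mul]
    intro h
    have := Nat.le_of_dvd (by omega) (orderOf_dvd_of_pow_eq_one h)
    omega
  · intro c
    cases c
    · exact h1
    · refine Eq.trans (Eq.symm ?_) h1
      refine (Set.ncard_congr (fun s _ => g * s) ?_ ?_ ?_)
      · intro s hs
        have hs : s ^ m = 1 := hs
        simp [mul_pow, hs]
      · intro s t _ _ h
        exact mul_left_cancel h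
      · intro s hs
        have hs : s ^ m = g ^ m := hs
        exact ⟨g⁻¹ * s, by simp [mul_pow, hs], by simp⟩

lemma card_vert [Finite F] : Nat.card (Vert F) = 4 * (Nat.card F) ^ 2 - 4 := by
  classical
  have := Fintype.ofFinite F
  rw [Nat.card_eq_fintype_card, Nat.card_eq_fintype_card, Fintype.card_prod, Fintype.card_prod,
    Fintype.card_bool, Fintype.card_subtype_compl, Fintype.card_prod, Fintype.card_subtype_eq,
    pow_two]
  omega

end MixedCage

/-- For every odd prime power `q ≥ 9` with `q ≡ 1 (mod 4)` there is a
`[(q−1)/4, q; 6]`-mixed graph on exactly `4q² − 4` vertices; hence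
`n[(q−1)/4, q; 6] ≤ 4q² − 4`. -/
theorem mixed_cage_upper_bound_one_mod_four (q : ℕ) (hq : IsPrimePow q)
    (hqo : Odd q) (hq1 : q % 4 = 1) (hq9 : 9 ≤ q) :
    ∃ (V : Type) (_ : Fintype V) (E A : V → V → Prop),
      IsZRSixMixedGraph ((q - 1) / 4) q E A ∧ Nat.card V = 4 * q ^ 2 - 4 := by
  classical
  obtain ⟨fld⟩ : Nonempty (Field (Fin q)) := Fintype.nonempty_field_iff.2 (by simpa using hq)
  generalize hFF : Fin q = F at fld
  have hfin : Finite F := hFF ▸ inferInstance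
  have hcard : Nat.card F = q := by rw [← hFF]; simp
  obtain ⟨i, hi, hc⟩ := MixedCage.unit_data (F := F) (m := (q - 1) / 4) (by omega)
    (by rw [hcard]; omega)
  refine ⟨MixedCage.Vert F, Fintype.ofFinite _, MixedCage.EE, MixedCage.AA ((q - 1) / 4) i,
    ⟨⟨fun u v h => MixedCage.EE_symm h, ?_, ?_, ?_⟩, ?_, ?_, ?_, ?_, ?_⟩, ?_⟩
  · intro v h
    have := h.2.1
    cases hv : v.2.1 <;> simp [hv] at this
  · intro v h
    have := h.1
    cases hv : v.1 <;> simp [hv] at this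
  · intro u v h
    exact ⟨fun h' => MixedCage.E_A_contra h h',
      fun h' => MixedCage.E_A_contra (MixedCage.EE_symm h) h'⟩
  · intro v; rw [MixedCage.card_out, hc]
  · intro v; rw [MixedCage.card_in, hc]
  · intro v; rw [MixedCage.card_E, hcard]
  · exact MixedCage.hexagon
  · intro k hk
    exact MixedCage.girth_lower hi hk
  · rw [MixedCage.card_vert, hcard]
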